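/- Let (v,z) ∈ S. Then for every sample i ∈ I and every decision node k ∈ K, the quantity L(i,k) = ∑_{j∈J} a^i_j z^k_j lies in {0,1}; moreover L(i,k) = 1 if and only if there exists a feature j ∈ J with a^i_j = 1 and z^k_j = 1. -/

import Mathlib

open scoped Classical
open Finset

/-- The categorical-data property: each entry of `a` is `0` or `1`, and within each
group the entries of each sample's feature vector sum to `1`. -/
def Categorical {I J G : Type*} [Fintype J] (g : J → G) (a : I → J → ℝ) : Prop :=
  (∀ i j, a i j = 0 ∨ a i j = 1) ∧
  (∀ (i : I) (h : G), ∑ j ∈ Finset.univ.filter (fun j => g j = h), a i j = 1)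

/-- Membership in the set `S`: `v` and `z` are `0/1`-valued, exactly one group is
selected at each decision node, and a feature can be selected only if its group is. -/
def memS {J G K : Type*} [Fintype G] (g : J → G)
    (v : K → G → ℝ) (z : K → J → ℝ) : Prop :=
  (∀ k h, v k h = 0 ∨ v k h = 1) ∧
  (∀ k j, z k j = 0 ∨ z k j = 1) ∧
  (∀ k, ∑ h, v k h = 1) ∧
  (∀ k j, z k j ≤ v k (g j))

/-- `L(i,k) = ∑_j a^i_j z^k_j`. -/
def Lfun {I J K : Type*} [Fintype J] (a : I → J → ℝ) (z : K → J → ℝ) (i : I) (k : K) : ℝ :=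
  ∑ j, a i j * z k j

/-- `R(i,k) = 1 - L(i,k)`. -/
def Rfun {I J K : Type*} [Fintype J] (a : I → J → ℝ) (z : K → J → ℝ) (i : I) (k : K) : ℝ :=
  1 - Lfun a z i k

/-- A `0/1`-valued function with sum `1` takes the value `1` at most once. -/
theorem eq_of_sum_eq_one_of_zero_or_one {α : Type*} {s : Finset α} {f : α → ℝ}
    (hf : ∀ x, f x = 0 ∨ f x = 1) (hs : ∑ x ∈ s, f x = 1) {x y : α}
    (hxs : x ∈ s) (hys : y ∈ s) (hx : f x = 1) (hy : f y = 1) : x = y := by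
  by_contra hxy
  have hnonneg : ∀ w ∈ s, 0 ≤ f w := fun w _ => by
    rcases hf w with h | h <;> simp [h]
  have hle := Finset.add_le_sum hnonneg hxs hys hxy
  linarith

/-- Proposition 1. For `(v,z) ∈ S`, every `L(i,k)` lies in `{0,1}`,
and `L(i,k) = 1` iff there is a feature `j` with `a^i_j = 1` and `z^k_j = 1`. -/
theorem lfun_mem_zero_one_and_eq_one_iff
    {I J G K : Type*} [Fintype J] [Fintype G]
    (g : J → G) (a : I → J → ℝ) (hcat : Categorical g a)
    (v : K → G → ℝ) (z : K → J → ℝ) (hS : memS g v z) :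
    ∀ (i : I) (k : K),
      (Lfun a z i k = 0 ∨ Lfun a z i k = 1) ∧
      (Lfun a z i k = 1 ↔ ∃ j : J, a i j = 1 ∧ z k j = 1) := by
  intro i k
  obtain ⟨ha, hasum⟩ := hcat
  obtain ⟨hv, hz, hvsum, hzv⟩ := hS
  have hv_one : ∀ j, z k j = 1 → v k (g j) = 1 := fun j hj =>
    (hv k (g j)).resolve_left fun h0 => by linarith [hzv k j]
  by_cases hex : ∃ j, a i j = 1 ∧ z k j = 1
  · have hL : Lfun a z i k = 1 := by
      obtain ⟨j, haj, hzj⟩ := hex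
      rw [Lfun, Finset.sum_eq_single_of_mem j (Finset.mem_univ j), haj, hzj, one_mul]
      intro l _ hlj
      rcases ha i l with hal | hal
      · simp [hal]
      rcases hz k l with hzl | hzl
      · simp [hzl]
      have hg : g l = g j :=
        eq_of_sum_eq_one_of_zero_or_one (hv k) (hvsum k) (Finset.mem_univ _)
          (Finset.mem_univ _) (hv_one l hzl) (hv_one j hzj)
      exact absurd (eq_of_sum_eq_one_of_zero_or_one (ha i) (hasum i (g j))
        (by simp [hg]) (by simp) hal haj) hlj
    exact ⟨Or.inr hL, fun _ => hex, fun _ => hL⟩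
  · have hL : Lfun a z i k = 0 := Finset.sum_eq_zero fun j _ => by
      rcases ha i j with haj | haj
      · simp [haj]
      rcases hz k j with hzj | hzj
      · simp [hzj]
      exact absurd ⟨j, haj, hzj⟩ hex
    exact ⟨Or.inl hL, fun h1 => absurd (hL.symm.trans h1) zero_ne_one, fun h => absurd h hex⟩
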